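/- Let q be complex with |q| < 1, and let a, b be complex numbers such that a q^m != 1 and b q^m != 1 for all integers m >= 1, and a b q^m != 1 for all integers m >= 0. Then (a - b) * sum_{j >= 0} (ab;q)_{2j} q^j / ((q;q)_j (aq;q)_j (bq;q)_j (ab;q)_j) = sum_{j >= 0} q^j ( a / ((q;q)_j (aq;q)_j (bq;q)_inf) - b / ((q;q)_j (bq;q)_j (aq;q)_inf) ). -/

import Mathlib

open scoped BigOperators

noncomputable section

/-- Finite q-Pochhammer symbol `(a;q)_n`. -/
def qP (q a : ℂ) (n : ℕ) : ℂ := ∏ m ∈ Finset.range n, (1 - a * q ^ m)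

/-- Infinite q-Pochhammer symbol `(a;q)_∞`. -/
def qPInf (q a : ℂ) : ℂ := ∏' m : ℕ, (1 - a * q ^ m)

open Filter Topology Finset in
theorem qP_mult (q z : ℂ) (hq : ‖q‖ < 1) : Multipliable (fun m : ℕ => (1 - z * q ^ m)) := by
  have : Summable (fun m : ℕ => ‖-(z * q ^ m)‖) := by
    simp only [norm_neg, norm_mul, norm_pow]
    exact (summable_geometric_of_lt_one (norm_nonneg _) hq).mul_left _
  simpa [sub_eq_add_neg] using multipliable_one_add_of_summable this

open Filter Topology Finset in
theorem qP_tendsto (q z : ℂ) (hq : ‖q‖ < 1) :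
    Tendsto (fun n => qP q z n) atTop (𝓝 (qPInf q z)) :=
  (qP_mult q z hq).tendsto_prod_tprod_nat

theorem qPInf_ne (q z : ℂ) (hq : ‖q‖ < 1) (h : ∀ m : ℕ, z * q ^ m ≠ 1) : qPInf q z ≠ 0 := by
  have hs : Summable (fun m : ℕ => ‖-(z * q ^ m)‖) := by
    simp only [norm_neg, norm_mul, norm_pow]
    exact (summable_geometric_of_lt_one (norm_nonneg _) hq).mul_left _
  have := tprod_one_add_ne_zero_of_summable (f := fun m : ℕ => -(z * q ^ m)) (fun m => by
    intro h0
    apply h m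
    linear_combination -h0) hs
  simpa [qPInf, sub_eq_add_neg] using this

theorem qP_ne (q z : ℂ) (h : ∀ m : ℕ, z * q ^ m ≠ 1) (n : ℕ) : qP q z n ≠ 0 := by
  unfold qP
  refine Finset.prod_ne_zero_iff.2 fun m _ h0 => h m ?_
  linear_combination -h0

theorem qP_zero (q z : ℂ) : qP q z 0 = 1 := by simp [qP]

theorem qP_succ (q z : ℂ) (n : ℕ) : qP q z (n + 1) = qP q z n * (1 - z * q ^ n) := by
  simp [qP, Finset.prod_range_succ]

theorem qP_succ' (q z : ℂ) (n : ℕ) : qP q z (n + 1) = (1 - z) * qP q (z * q) n := by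
  simp only [qP, Finset.prod_range_succ']
  rw [mul_comm]
  congr 1
  · simp
  · refine Finset.prod_congr rfl fun m _ => ?_
    ring

theorem qP_add (q z : ℂ) (m n : ℕ) : qP q z (m + n) = qP q z m * qP q (z * q ^ m) n := by
  simp only [qP, Finset.prod_range_add]
  congr 1
  refine Finset.prod_congr rfl fun k _ => ?_
  ring

theorem qPInf_split (q z : ℂ) (hq : ‖q‖ < 1) (n : ℕ) :
    qPInf q z = qP q z n * qPInf q (z * q ^ n) := by
  refine tendsto_nhds_unique ((Filter.tendsto_add_atTop_iff_nat n).2 (qP_tendsto q z hq)) ?_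
  have := (qP_tendsto q (z * q ^ n) hq).const_mul (qP q z n)
  refine this.congr fun m => ?_
  rw [← qP_add, add_comm]

theorem qq_ne (q : ℂ) (hq : ‖q‖ < 1) (m : ℕ) : q * q ^ m ≠ 1 := by
  intro h
  have h1 : ‖q ^ (m + 1)‖ = 1 := by rw [pow_succ', h]; simp
  rw [norm_pow] at h1
  have := pow_lt_one₀ (norm_nonneg q) hq (Nat.succ_ne_zero m)
  simp at this h1
  linarith

theorem Q_ne (q : ℂ) (hq : ‖q‖ < 1) (n : ℕ) : qP q q n ≠ 0 := qP_ne q q (qq_ne q hq) n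

theorem Q_succ (q : ℂ) (n : ℕ) : qP q q (n + 1) = qP q q n * (1 - q ^ (n + 1)) := by
  rw [qP_succ, pow_succ']

open Filter Topology in
theorem Q_bound (q : ℂ) (hq : ‖q‖ < 1) : ∃ C : ℝ, 0 ≤ C ∧ ∀ n, ‖(qP q q n)⁻¹‖ ≤ C := by
  have h := (qP_tendsto q q hq).inv₀ (qPInf_ne q q hq (qq_ne q hq))
  obtain ⟨C, hC⟩ := (Metric.isBounded_range_of_tendsto _ h).exists_norm_le
  exact ⟨C, (norm_nonneg _).trans (hC _ ⟨0, rfl⟩), fun n => hC _ ⟨n, rfl⟩⟩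

theorem ch_add (m n : ℕ) : (m + n).choose 2 = m.choose 2 + n.choose 2 + m * n := by
  induction n with
  | zero => simp
  | succ n ih =>
    rw [← add_assoc, Nat.choose_succ_succ' (m + n) 1, Nat.choose_succ_succ' n 1, ih]
    simp
    ring

theorem ch_succ (n : ℕ) : (n + 1).choose 2 = n.choose 2 + n := by
  simp [ch_add]

open Filter Topology in
theorem summ_theta (x r : ℝ) (hx : 0 ≤ x) (hr : 0 ≤ r) (hr1 : r < 1) :
    Summable (fun n : ℕ => x ^ n * r ^ (n.choose 2)) := by
  have ht : Tendsto (fun n : ℕ => x * r ^ n) atTop (𝓝 0) := by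
    simpa using (tendsto_pow_atTop_nhds_zero_of_lt_one hr hr1).const_mul x
  refine summable_of_ratio_norm_eventually_le (r := 1/2) (by norm_num) ?_
  filter_upwards [ht.eventually (gt_mem_nhds (show (0:ℝ) < 1/2 by norm_num))] with n hn
  rw [Real.norm_of_nonneg (by positivity), Real.norm_of_nonneg (by positivity), ch_succ]
  calc x ^ (n+1) * r ^ (n.choose 2 + n) = (x * r ^ n) * (x ^ n * r ^ (n.choose 2)) := by ring
    _ ≤ _ := by gcongr

/-- Euler: `1/(z;q)_∞`-type sum at `z = q^(N+1)`. -/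
theorem euler2 (q : ℂ) (hq : ‖q‖ < 1) (N : ℕ) :
    HasSum (fun j : ℕ => qPInf q q * q ^ (j * (N + 1)) / qP q q j) (qP q q N) := by
  have hi := qPInf_ne q q hq (qq_ne q hq)
  obtain ⟨C, hC0, hC⟩ := Q_bound q hq
  have hs : ∀ N : ℕ, Summable (fun j : ℕ => qPInf q q * q ^ (j * (N + 1)) / qP q q j) := by
    intro N
    refine Summable.of_norm_bounded (g := fun j => ‖qPInf q q‖ * C * ‖q‖ ^ j)
      ((summable_geometric_of_lt_one (norm_nonneg _) hq).mul_left _) fun j => ?_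
    rw [div_eq_mul_inv, norm_mul, norm_mul, norm_pow]
    have h1 : ‖q‖ ^ (j * (N + 1)) ≤ ‖q‖ ^ j :=
      pow_le_pow_of_le_one (norm_nonneg _) hq.le (by nlinarith)
    calc _ ≤ ‖qPInf q q‖ * ‖q‖ ^ j * C := by gcongr; exact hC j
      _ = _ := by ring
  induction N with
  | zero =>
    refine (hs 0).hasSum_iff_tendsto_nat.2 ?_
    have hp : ∀ n : ℕ, ∑ j ∈ Finset.range (n + 1), qPInf q q * q ^ (j * (0 + 1)) / qP q q j
        = qPInf q q / qP q q n := by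
      intro n
      induction n with
      | zero => simp [qP_zero]
      | succ n ih =>
        rw [Finset.sum_range_succ, ih, Q_succ]
        have h1 := Q_ne q hq n
        have h2 := Q_ne q hq (n + 1)
        rw [Q_succ] at h2
        have h3 := right_ne_zero_of_mul h2
        field_simp
        simp
    rw [← Filter.tendsto_add_atTop_iff_nat 1]
    simp only [hp]
    have := (tendsto_const_nhds (x := qPInf q q)).div (qP_tendsto q q hq) hi
    rw [div_self hi] at this
    rw [qP_zero]
    exact this
  | succ N ih =>
    have h1 := (hs (N + 1)).hasSum
    suffices h : ∑' j : ℕ, qPInf q q * q ^ (j * (N + 1 + 1)) / qP q q j = qP q q (N + 1) by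
      rwa [h] at h1
    have h2 := ih.sub h1
    have h3 := (hasSum_nat_add_iff' 1).2 h2
    have h4 := h3.unique ((ih.mul_left (q ^ (N + 1))).congr_fun ?_)
    · simp [qP_zero] at h4
      rw [Q_succ]
      linear_combination -h4
    · intro n
      have h1 := Q_ne q hq n
      have h2 := Q_ne q hq (n + 1)
      rw [Q_succ] at h2
      have h3 := right_ne_zero_of_mul h2
      rw [Q_succ]
      field_simp
      ring

open Filter Topology in
/-- Euler's expansion of `(z;q)_∞`. -/
theorem euler1 (q : ℂ) (hq : ‖q‖ < 1) (z : ℂ) :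
    HasSum (fun k : ℕ => (-1) ^ k * q ^ (k.choose 2) * z ^ k / qP q q k) (qPInf q z) := by
  obtain ⟨C, hC0, hC⟩ := Q_bound q hq
  have hb : ∀ z : ℂ, ∀ k : ℕ, ‖(-1) ^ k * q ^ (k.choose 2) * z ^ k / qP q q k‖
      ≤ C * (‖z‖ ^ k * ‖q‖ ^ (k.choose 2)) := by
    intro z k
    rw [div_eq_mul_inv, norm_mul, norm_mul, norm_mul, norm_pow, norm_pow, norm_pow]
    simp only [norm_neg, norm_one, one_pow, one_mul]
    calc _ ≤ ‖q‖ ^ (k.choose 2) * ‖z‖ ^ k * C := by gcongr; exact hC k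
      _ = _ := by ring
  have hbs : ∀ z : ℂ, Summable fun k : ℕ => C * (‖z‖ ^ k * ‖q‖ ^ (k.choose 2)) := fun z =>
    (summ_theta _ _ (norm_nonneg z) (norm_nonneg q) hq).mul_left C
  have hs : ∀ z : ℂ, Summable (fun k : ℕ => (-1) ^ k * q ^ (k.choose 2) * z ^ k / qP q q k) :=
    fun z => Summable.of_norm_bounded (hbs z) (hb z)
  set f : ℂ → ℂ := fun z => ∑' k : ℕ, (-1) ^ k * q ^ (k.choose 2) * z ^ k / qP q q k with hf
  have hrec : ∀ z, f z = (1 - z) * f (z * q) := by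
    intro z
    have h2 := (hs z).hasSum.sub (hs (z * q)).hasSum
    have h3 := (hasSum_nat_add_iff' 1).2 h2
    have h4 := h3.unique (((hs (z * q)).hasSum.mul_left (-z)).congr_fun ?_)
    · simp [qP_zero] at h4
      simp only [hf]
      linear_combination h4
    · intro n
      have h1 := Q_ne q hq n
      have h2 := Q_ne q hq (n + 1)
      rw [Q_succ] at h2
      have h3 := right_ne_zero_of_mul h2
      rw [Q_succ, ch_succ]
      field_simp
      ring
  have hN : ∀ n : ℕ, f z = qP q z n * f (z * q ^ n) := by
    intro n
    induction n with
    | zero => simp [qP_zero]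
    | succ n ih => rw [ih, hrec, qP_succ]; ring_nf
  have hlim : Tendsto (fun n : ℕ => f (z * q ^ n)) atTop (𝓝 1) := by
    have h0 : f 0 = 1 := by
      simp only [hf]
      rw [tsum_eq_single 0]
      · simp [qP_zero]
      · intro k hk; simp [hk]
    rw [← h0]
    refine tendsto_tsum_of_dominated_convergence (hbs z) ?_ ?_
    · intro k
      have : Tendsto (fun n : ℕ => z * q ^ n) atTop (𝓝 0) := by
        simpa using (tendsto_pow_atTop_nhds_zero_of_norm_lt_one hq).const_mul z
      exact ((this.pow k).const_mul _).div_const _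
    · filter_upwards with n k
      refine (hb _ k).trans ?_
      gcongr
      rw [norm_mul, norm_pow]
      exact mul_le_of_le_one_right (norm_nonneg _) (pow_le_one₀ (norm_nonneg _) hq.le)
  have : f z = qPInf q z := by
    refine tendsto_nhds_unique (tendsto_const_nhds (x := f z) (f := (atTop : Filter ℕ))) ?_
    have := (qP_tendsto q z hq).mul hlim
    simp only [mul_one] at this
    exact this.congr fun n => (hN n).symm
  rw [← this]
  exact (hs z).hasSum

/-- Weighted q-binomial sum. -/
def qD (q : ℂ) (m : ℕ) (f : ℕ → ℕ → ℂ) : ℂ :=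
  ∑ x ∈ Finset.HasAntidiagonal.antidiagonal m,
    (-1) ^ x.1 * q ^ (x.1.choose 2) * (qP q q m / (qP q q x.1 * qP q q x.2)) * f x.2 x.1

theorem qD_succ (q : ℂ) (hq : ‖q‖ < 1) (m : ℕ) (f : ℕ → ℕ → ℂ) :
    qD q (m + 1) f = qD q m (fun k i => q ^ i * (f (k + 1) i - f k (i + 1))) := by
  have hQ := Q_ne q hq
  have h1 : qD q (m + 1) f
      = ∑ x ∈ Finset.HasAntidiagonal.antidiagonal (m + 1), (-1) ^ x.1 * q ^ (x.1.choose 2) *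
          (qP q q m / (qP q q x.1 * qP q q x.2)) * (q ^ x.1 * (1 - q ^ x.2)) * f x.2 x.1
        + ∑ x ∈ Finset.HasAntidiagonal.antidiagonal (m + 1), (-1) ^ x.1 * q ^ (x.1.choose 2) *
          (qP q q m / (qP q q x.1 * qP q q x.2)) * (1 - q ^ x.1) * f x.2 x.1 := by
    rw [← Finset.sum_add_distrib]
    refine Finset.sum_congr rfl fun x hx => ?_
    rw [Finset.HasAntidiagonal.mem_antidiagonal] at hx
    rw [Q_succ, ← hx, pow_add]
    ring
  rw [h1, Finset.Nat.sum_antidiagonal_succ', Finset.Nat.sum_antidiagonal_succ]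
  simp only [pow_zero, sub_self, mul_zero, zero_mul, zero_add]
  rw [← Finset.sum_add_distrib]
  refine Finset.sum_congr rfl fun x hx => ?_
  have h3 : ∀ n, (1 - q ^ (n + 1)) ≠ 0 := fun n => by
    have := hQ (n + 1)
    rw [Q_succ] at this
    exact right_ne_zero_of_mul this
  have := hQ x.1
  have := hQ x.2
  have := h3 x.1
  have := h3 x.2
  rw [Q_succ, Q_succ, ch_succ]
  field_simp
  ring

theorem qD_mul (q c : ℂ) (m : ℕ) (f g : ℕ → ℕ → ℂ) (h : ∀ k i, i + k = m → g k i = c * f k i) :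
    qD q m g = c * qD q m f := by
  unfold qD
  rw [Finset.mul_sum]
  refine Finset.sum_congr rfl fun x hx => ?_
  rw [h _ _ (Finset.HasAntidiagonal.mem_antidiagonal.1 hx)]
  ring

theorem qbinom (q : ℂ) (hq : ‖q‖ < 1) (m : ℕ) (z : ℂ) : qD q m (fun _ i => z ^ i) = qP q z m := by
  induction m generalizing z with
  | zero => simp [qD, qP_zero]
  | succ m ih =>
    rw [qD_succ q hq, qP_succ', ← ih]
    refine qD_mul _ _ _ _ _ fun k i _ => ?_
    ring

/-- `1/(q;q)_{n-i}`, zero when `i > n`. -/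
def qr (q : ℂ) (n i : ℕ) : ℂ := if i ≤ n then (qP q q (n - i))⁻¹ else 0

theorem qcv (q : ℂ) (hq : ‖q‖ < 1) (m n : ℕ) :
    qD q m (fun k i => qP q q (n + k) * qr q n i) = q ^ (m * n) * qP q q m := by
  induction m with
  | zero =>
    have := Q_ne q hq n
    simp [qD, qP_zero, qr, this]
  | succ m ih =>
    have : q ^ ((m + 1) * n) * qP q q (m + 1)
        = (q ^ n * (1 - q ^ (m + 1))) * (q ^ (m * n) * qP q q m) := by rw [Q_succ]; ring
    rw [qD_succ q hq, this, ← ih]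
    refine qD_mul _ _ _ _ _ fun k i hik => ?_
    subst hik
    unfold qr
    rcases lt_trichotomy i n with h | h | h
    · obtain ⟨l, rfl⟩ := Nat.exists_eq_add_of_lt h
      have e1 : i + l + 1 - i = l + 1 := by omega
      have e2 : i + l + 1 - (i + 1) = l := by omega
      rw [if_pos (by omega), if_pos (by omega), e1, e2]
      rw [show i + l + 1 + (k + 1) = (i + l + 1 + k) + 1 by ring, Q_succ, Q_succ q l]
      have h1 := Q_ne q hq l
      have h2 := Q_ne q hq (l + 1)
      rw [Q_succ] at h2
      have h3 := right_ne_zero_of_mul h2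
      field_simp
      ring
    · subst h
      rw [if_pos le_rfl, if_neg (by omega)]
      rw [show i + (k + 1) = (i + k) + 1 by ring, Q_succ]
      simp [qP_zero]
      ring
    · rw [if_neg (by omega), if_neg (by omega)]
      simp

theorem hasSum_anti (f : ℕ × ℕ → ℂ) (X : ℂ) (h : HasSum f X) :
    HasSum (fun n => ∑ x ∈ Finset.HasAntidiagonal.antidiagonal n, f x) X := by
  have h1 := (Finset.HasAntidiagonal.sigmaAntidiagonalEquivProd (A := ℕ)).hasSum_iff.2 h
  refine h1.sigma fun n => ?_
  have := (Finset.HasAntidiagonal.antidiagonal n).hasSum f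
  exact this

def antiEquiv : (Σ p : ℕ × ℕ, Finset.HasAntidiagonal.antidiagonal p.1) ≃ (ℕ × ℕ) × ℕ where
  toFun s := (s.2.1, s.1.2)
  invFun y := ⟨(y.1.1 + y.1.2, y.2), ⟨y.1, by simp⟩⟩
  left_inv := by
    rintro ⟨⟨m, n⟩, ⟨⟨i, k⟩, h⟩⟩
    have h' := Finset.HasAntidiagonal.mem_antidiagonal.1 h
    simp only at h'
    subst h'
    rfl
  right_inv := by
    rintro ⟨⟨i, k⟩, n⟩
    rfl

theorem hasSum_anti' (f : (ℕ × ℕ) × ℕ → ℂ) (X : ℂ) (h : HasSum f X) :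
    HasSum (fun p : ℕ × ℕ => ∑ x ∈ Finset.HasAntidiagonal.antidiagonal p.1, f (x, p.2)) X := by
  have h1 := antiEquiv.hasSum_iff.2 h
  refine h1.sigma fun p => ?_
  exact (Finset.HasAntidiagonal.antidiagonal p.1).hasSum (fun x => f (x, p.2))

/-- The quadruple-sum term, index `((i,j),(k,n))`. -/
def qF (q a b : ℂ) (x : (ℕ × ℕ) × (ℕ × ℕ)) : ℂ :=
  qPInf q q * (-1) ^ (x.2.1 + x.2.2) * a ^ (x.1.1 + x.2.1) * b ^ x.2.2 *
    q ^ ((x.1.1 + x.2.1 + 1).choose 2 + (x.2.2 + 1).choose 2 + x.1.1.choose 2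
      + x.1.2 * (x.2.1 + x.2.2 + 1)) *
    qr q x.2.2 x.1.1 * (qP q q x.1.2)⁻¹ * (qP q q x.1.1)⁻¹ * (qP q q x.2.1)⁻¹

theorem qF_summable (q a b : ℂ) (hq : ‖q‖ < 1) : Summable (qF q a b) := by
  obtain ⟨C, hC0, hC⟩ := Q_bound q hq
  have hr : ∀ n i, ‖qr q n i‖ ≤ C := by
    intro n i
    unfold qr
    split_ifs
    · exact hC _
    · simpa using hC0
  have sa := summ_theta ‖a‖ ‖q‖ (norm_nonneg _) (norm_nonneg _) hq
  have sb := summ_theta ‖b‖ ‖q‖ (norm_nonneg _) (norm_nonneg _) hq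
  have sg := summable_geometric_of_lt_one (norm_nonneg _) hq
  have s1 := sa.mul_of_nonneg sg (fun _ => by positivity) (fun _ => by positivity)
  have s2 := sa.mul_of_nonneg sb (fun _ => by positivity) (fun _ => by positivity)
  have s3 := s1.mul_of_nonneg s2 (fun _ => by positivity) (fun _ => by positivity)
  refine Summable.of_norm_bounded (s3.mul_left (‖qPInf q q‖ * C ^ 4)) ?_
  rintro ⟨⟨i, j⟩, ⟨k, n⟩⟩
  simp only [qF, norm_mul, norm_pow, norm_neg, norm_one, one_pow, mul_one]
  have he : ‖q‖ ^ ((i + k + 1).choose 2 + (n + 1).choose 2 + i.choose 2 + j * (k + n + 1))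
      ≤ ‖q‖ ^ (i.choose 2 + j + (k.choose 2 + n.choose 2)) := by
    refine pow_le_pow_of_le_one (norm_nonneg _) hq.le ?_
    rw [ch_succ, ch_succ, ch_add]
    have : j ≤ j * (k + n + 1) := Nat.le_mul_of_pos_right _ (by omega)
    have : 0 ≤ i * k := Nat.zero_le _
    omega
  calc _ ≤ ‖qPInf q q‖ * ‖a‖ ^ (i + k) * ‖b‖ ^ n *
        ‖q‖ ^ (i.choose 2 + j + (k.choose 2 + n.choose 2)) * C * C * C * C := by
        gcongr
        · exact hr _ _
        · exact hC _
        · exact hC _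
        · exact hC _
    _ = _ := by ring

theorem key1 (q a b : ℂ) (hq : ‖q‖ < 1) (X : ℂ) (hX : HasSum (qF q a b) X) :
    HasSum (fun j : ℕ => qPInf q q / qP q q j * q ^ j * qP q (a * b * q ^ j) j *
      qPInf q (a * q ^ (j + 1)) * qPInf q (b * q ^ (j + 1))) X := by
  have hin : ∀ x : ℕ × ℕ, HasSum (fun y => qF q a b (x, y))
      (qPInf q q * q ^ (x.1 + x.2) * (-1) ^ x.1 * q ^ (x.1.choose 2) *
        (a * b * q ^ (x.1 + x.2)) ^ x.1 * (qP q q x.1)⁻¹ * (qP q q x.2)⁻¹ *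
        (qPInf q (a * q ^ (x.1 + x.2 + 1)) * qPInf q (b * q ^ (x.1 + x.2 + 1)))) := by
    rintro ⟨i, j⟩
    simp only
    set c := qPInf q q * q ^ (i + j) * (-1) ^ i * q ^ (i.choose 2) *
        (a * b * q ^ (i + j)) ^ i * (qP q q i)⁻¹ * (qP q q j)⁻¹ with hc
    have hA := euler1 q hq (a * q ^ (i + j + 1))
    have hB := euler1 q hq (b * q ^ (i + j + 1))
    set u : ℕ → ℂ := fun k => (-1) ^ k * q ^ k.choose 2 * (b * q ^ (i + j + 1)) ^ k / qP q q k with hu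
    have hB' : HasSum (fun n => if i ≤ n then u (n - i) else 0) (qPInf q (b * q ^ (i + j + 1))) := by
      have := (hasSum_nat_add_iff' (f := fun n => if i ≤ n then u (n - i) else 0)
        (g := qPInf q (b * q ^ (i + j + 1))) i).1
      refine this ?_
      rw [Finset.sum_eq_zero]
      · simpa using hB
      · intro n hn
        rw [if_neg]
        simpa using hn
    have heq : ∀ y : ℕ × ℕ, qF q a b ((i, j), y) =
        c * ((-1) ^ y.1 * q ^ y.1.choose 2 * (a * q ^ (i + j + 1)) ^ y.1 / qP q q y.1
          * (if i ≤ y.2 then u (y.2 - i) else 0)) := by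
      rintro ⟨k, n⟩
      simp only [qF, qr]
      by_cases h : i ≤ n
      · obtain ⟨l, rfl⟩ := Nat.exists_eq_add_of_le h
        simp only [if_pos h, Nat.add_sub_cancel_left, hu, hc]
        have e : (i + k + 1).choose 2 + (i + l + 1).choose 2 + i.choose 2 + j * (k + (i + l) + 1)
          = (i + j) + i.choose 2 + (i + j) * i + k.choose 2 + (i + j + 1) * k
            + l.choose 2 + (i + j + 1) * l := by
          have : 2 * i.choose 2 + i = i * i := by
            clear * -
            induction i with
            | zero => simp
            | succ i ih => rw [ch_succ]; linarith
          simp only [ch_succ, ch_add]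
          linarith
        rw [e]
        have := Q_ne q hq
        simp only [div_eq_mul_inv, mul_pow, ← pow_mul, pow_add]
        ring
      · simp [if_neg h]
    have hsum : Summable (fun y => qF q a b ((i, j), y)) := hX.summable.prod_factor (i, j)
    by_cases hc0 : c = 0
    · simp only [heq, hc0, zero_mul]
      exact hasSum_zero
    simp only [heq] at hsum ⊢
    refine (hA.mul hB' ?_).mul_left c
    exact (summable_mul_left_iff hc0).1 hsum
  have h1 := hasSum_anti _ _ (hX.prod_fiberwise hin)
  refine h1.congr_fun fun j => ?_
  rw [← qbinom q hq j (a * b * q ^ j), qD]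
  simp only [Finset.mul_sum, Finset.sum_mul]
  refine Finset.sum_congr rfl fun x hx => ?_
  rw [Finset.HasAntidiagonal.mem_antidiagonal] at hx
  have := Q_ne q hq
  rw [hx]
  have h1 := this j
  have h2 := this x.1
  have h3 := this x.2
  field_simp

theorem key2 (q a b : ℂ) (hq : ‖q‖ < 1) (X : ℂ) (hX : HasSum (qF q a b) X) :
    HasSum (fun M : ℕ => (-1) ^ M * q ^ ((M + 1).choose 2) *
      ∑ x ∈ Finset.HasAntidiagonal.antidiagonal M, a ^ x.1 * b ^ x.2) X := by
  let e : ((ℕ × ℕ) × ℕ) × ℕ ≃ (ℕ × ℕ) × (ℕ × ℕ) :=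
    { toFun := fun y => ((y.1.1.1, y.2), (y.1.1.2, y.1.2))
      invFun := fun x => (((x.1.1, x.2.1), x.2.2), x.1.2)
      left_inv := fun _ => rfl
      right_inv := fun _ => rfl }
  have h1 := e.hasSum_iff.2 hX
  have h2 := h1.prod_fiberwise (g := fun y => (-1) ^ (y.1.2 + y.2) * a ^ (y.1.1 + y.1.2) * b ^ y.2 *
    q ^ ((y.1.1 + y.1.2 + 1).choose 2 + (y.2 + 1).choose 2 + y.1.1.choose 2) *
    qr q y.2 y.1.1 * (qP q q y.1.1)⁻¹ * (qP q q y.1.2)⁻¹ * qP q q (y.1.2 + y.2)) (by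
      rintro ⟨⟨i, k⟩, n⟩
      refine ((euler2 q hq (k + n)).mul_left _).congr_fun fun j => ?_
      simp only [e, qF, Function.comp, Equiv.coe_fn_mk, div_eq_mul_inv, pow_add q _ (j * (k + n + 1))]
      ring)
  have h3 := hasSum_anti' _ _ h2
  have h4 : HasSum (fun p : ℕ × ℕ => (-1) ^ (p.1 + p.2) * q ^ ((p.1 + p.2 + 1).choose 2) *
      (a ^ p.1 * b ^ p.2)) X := by
    refine h3.congr_fun ?_
    rintro ⟨m, n⟩
    have hcv := qcv q hq m n
    have hQ := Q_ne q hq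
    have hm := hQ m
    have e1 : q ^ ((m + n + 1).choose 2) = q ^ ((m + 1).choose 2 + (n + 1).choose 2) *
        (qD q m (fun k i => qP q q (n + k) * qr q n i) / qP q q m) := by
      rw [hcv, mul_div_cancel_right₀ _ hm, ← pow_add]
      congr 1
      simp only [ch_succ, ch_add]
      ring
    simp only
    rw [e1, qD]
    simp only [Finset.mul_sum, Finset.sum_mul, Finset.sum_div]
    refine Finset.sum_congr rfl fun x hx => ?_
    rw [Finset.HasAntidiagonal.mem_antidiagonal] at hx
    have h5 := hQ x.1
    have h6 := hQ x.2
    have e3 : ((-1 : ℂ)) ^ (m + n) * (-1) ^ x.1 = (-1) ^ (x.2 + n) := by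
      rw [← hx, ← pow_add, show x.1 + x.2 + n + x.1 = 2 * x.1 + (x.2 + n) by ring, pow_add, pow_mul]
      simp
    rw [hx, ← e3, add_comm x.2 n]
    field_simp
    ring
  refine (hasSum_anti _ _ h4).congr_fun fun M => ?_
  rw [Finset.mul_sum]
  refine Finset.sum_congr rfl fun x hx => ?_
  rw [Finset.HasAntidiagonal.mem_antidiagonal.1 hx]

theorem antidiag_geom (a b : ℂ) (M : ℕ) :
    (a - b) * ∑ x ∈ Finset.HasAntidiagonal.antidiagonal M, a ^ x.1 * b ^ x.2 = a ^ (M + 1) - b ^ (M + 1) := by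
  induction M with
  | zero => simp
  | succ M ih =>
    rw [Finset.Nat.sum_antidiagonal_succ]
    have : ∑ x ∈ Finset.HasAntidiagonal.antidiagonal M, a ^ (x.1 + 1) * b ^ x.2
        = a * ∑ x ∈ Finset.HasAntidiagonal.antidiagonal M, a ^ x.1 * b ^ x.2 := by
      rw [Finset.mul_sum]
      exact Finset.sum_congr rfl fun x _ => by ring
    simp only [this]
    linear_combination a * ih

theorem keyHas (q a b : ℂ) (hq : ‖q‖ < 1) : ∃ X,
    HasSum (fun j : ℕ => qPInf q q / qP q q j * q ^ j * qP q (a * b * q ^ j) j *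
      qPInf q (a * q ^ (j + 1)) * qPInf q (b * q ^ (j + 1))) X ∧
    HasSum (fun M : ℕ => (-1) ^ M * q ^ ((M + 1).choose 2) * (a ^ (M + 1) - b ^ (M + 1)))
      ((a - b) * X) := by
  have h := (qF_summable q a b hq).hasSum
  refine ⟨_, key1 q a b hq _ h, ((key2 q a b hq _ h).mul_left (a - b)).congr_fun fun M => ?_⟩
  rw [← antidiag_geom]
  ring

theorem keyHas0 (q a : ℂ) (hq : ‖q‖ < 1) : ∃ X,
    HasSum (fun j : ℕ => qPInf q q / qP q q j * q ^ j * qPInf q (a * q ^ (j + 1))) X ∧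
    HasSum (fun M : ℕ => (-1) ^ M * q ^ ((M + 1).choose 2) * a ^ (M + 1)) (a * X) := by
  obtain ⟨X, h1, h2⟩ := keyHas q a 0 hq
  refine ⟨X, ?_, ?_⟩
  · simpa [qP, qPInf] using h1
  · simpa using h2

/-- Equation (3.15) of the paper. -/
theorem key_ab_identity (q a b : ℂ) (hq : ‖q‖ < 1)
    (ha : ∀ m : ℕ, 1 ≤ m → a * q ^ m ≠ 1)
    (hb : ∀ m : ℕ, 1 ≤ m → b * q ^ m ≠ 1)
    (hab : ∀ m : ℕ, a * b * q ^ m ≠ 1) :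
    (a - b) * ∑' j : ℕ,
      qP q (a * b) (2 * j) * q ^ j /
        (qP q q j * qP q (a * q) j * qP q (b * q) j * qP q (a * b) j)
    = ∑' j : ℕ,
        q ^ j * (a / (qP q q j * qP q (a * q) j * qPInf q (b * q))
          - b / (qP q q j * qP q (b * q) j * qPInf q (a * q))) := by
  have ha' : ∀ m : ℕ, a * q * q ^ m ≠ 1 := fun m => by
    have := ha (m + 1) (by omega)
    rwa [pow_succ', ← mul_assoc] at this
  have hb' : ∀ m : ℕ, b * q * q ^ m ≠ 1 := fun m => by
    have := hb (m + 1) (by omega)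
    rwa [pow_succ', ← mul_assoc] at this
  have hA := qP_ne q _ ha'
  have hB := qP_ne q _ hb'
  have hAi := qPInf_ne q _ hq ha'
  have hBi := qPInf_ne q _ hq hb'
  have hQi := qPInf_ne q _ hq (qq_ne q hq)
  have hQ := Q_ne q hq
  have hABn := qP_ne q _ hab
  have sA : ∀ j, qPInf q (a * q ^ (j + 1)) = qPInf q (a * q) / qP q (a * q) j := fun j => by
    rw [qPInf_split q (a * q) hq j, mul_div_cancel_left₀ _ (hA j)]
    ring_nf
  have sB : ∀ j, qPInf q (b * q ^ (j + 1)) = qPInf q (b * q) / qP q (b * q) j := fun j => by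
    rw [qPInf_split q (b * q) hq j, mul_div_cancel_left₀ _ (hB j)]
    ring_nf
  obtain ⟨X, h1, h2⟩ := keyHas q a b hq
  obtain ⟨Y, h3, h4⟩ := keyHas0 q a hq
  obtain ⟨Z, h5, h6⟩ := keyHas0 q b hq
  have hXYZ : (a - b) * X = a * Y - b * Z := by
    refine h2.unique ((h4.sub h6).congr_fun fun M => ?_)
    ring
  set K := qPInf q q * qPInf q (a * q) * qPInf q (b * q) with hK
  have hL : HasSum (fun j : ℕ => qP q (a * b) (2 * j) * q ^ j /
        (qP q q j * qP q (a * q) j * qP q (b * q) j * qP q (a * b) j)) (X / K) := by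
    refine (h1.div_const K).congr_fun fun j => ?_
    rw [two_mul, qP_add, sA, sB, hK]
    have := hA j
    have := hB j
    have := hQ j
    have := hABn j
    field_simp
  have hR : HasSum (fun j : ℕ => q ^ j * (a / (qP q q j * qP q (a * q) j * qPInf q (b * q))
          - b / (qP q q j * qP q (b * q) j * qPInf q (a * q)))) ((a * Y - b * Z) / K) := by
    refine (((h3.mul_left a).sub (h5.mul_left b)).div_const K).congr_fun fun j => ?_
    rw [sA, sB, hK]
    have := hA j
    have := hB j
    have := hQ j
    generalize qP q (a * q) j = A at *
    generalize qP q (b * q) j = B at *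
    generalize qPInf q (a * q) = A' at *
    generalize qPInf q (b * q) = B' at *
    field_simp
  rw [hL.tsum_eq, hR.tsum_eq, ← hXYZ, mul_div_assoc]
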